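/- arXiv:1004.0273 — 9 statements merged into one kernel-verified Lean document; each statement's English description precedes it below -/
import Mathlib

section
/- Let Φ be an n×n Hermitian positive definite complex matrix and let i, j be distinct indices. Then the entry (Φ⁻¹) j i is zero if and only if the entry of the Wiener row W_j of Φ at j corresponding to index i is zero. (This is the paper's lemma relating conditional non-causal Wiener-uncorrelation of x_i and x_j given the other processes to the vanishing of entry (j,i) of the inverse cross-spectral density matrix, stated at a fixed frequency.) -/
open Matrix
open scoped ComplexOrder

/-- The Wiener row of `Φ` at `j`: the row vector `c_j * (Φ_j)⁻¹`, where
`(c_j)_k = Φ j k` for `k ≠ j` and `Φ_j` is the principal submatrix of `Φ`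
on the indices `k ≠ j`. -/
noncomputable def wienerRow {n : ℕ} (Φ : Matrix (Fin n) (Fin n) ℂ) (j : Fin n) :
    Matrix (Fin 1) {k : Fin n // k ≠ j} ℂ :=
  (Matrix.of fun (_ : Fin 1) (k : {k : Fin n // k ≠ j}) => Φ j k.val) *
    (Φ.submatrix (fun k : {k : Fin n // k ≠ j} => k.val)
      (fun k : {k : Fin n // k ≠ j} => k.val))⁻¹

theorem stmt_3 {n : ℕ} (Φ : Matrix (Fin n) (Fin n) ℂ) (hΦ : Φ.PosDef)
    (i j : Fin n) (hij : i ≠ j) :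
    Φ⁻¹ j i = 0 ↔ wienerRow Φ j 0 ⟨i, hij⟩ = 0 := by
  classical
  have hdet : IsUnit Φ.det := (Matrix.isUnit_iff_isUnit_det _).1 hΦ.isUnit
  have hsub : (Φ.submatrix (fun k : {k : Fin n // k ≠ j} => k.val)
      (fun k : {k : Fin n // k ≠ j} => k.val)).PosDef :=
    hΦ.submatrix Subtype.val_injective
  have hdet' := (Matrix.isUnit_iff_isUnit_det _).1 hsub.isUnit
  have hpos : Φ⁻¹ j j ≠ 0 := (hΦ.inv.diag_pos (i := j)).ne'
  have hmul : Φ⁻¹ * Φ = 1 := Matrix.nonsing_inv_mul _ hdet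
  have key : (Matrix.of fun (_ : Fin 1) (k : {k : Fin n // k ≠ j}) => Φ⁻¹ j k.val) *
      (Φ.submatrix (fun k : {k : Fin n // k ≠ j} => k.val)
        (fun k : {k : Fin n // k ≠ j} => k.val)) =
      (-(Φ⁻¹ j j)) • (Matrix.of fun (_ : Fin 1) (k : {k : Fin n // k ≠ j}) => Φ j k.val) := by
    ext a k
    have h := congrFun (congrFun hmul j) k.val
    rw [Matrix.mul_apply, Matrix.one_apply_ne k.2.symm,
      Fintype.sum_eq_add_sum_subtype_ne _ j] at h
    simp only [Matrix.mul_apply, Matrix.of_apply, Matrix.submatrix_apply, Matrix.smul_apply,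
      smul_eq_mul]
    linear_combination h
  have key2 : (Matrix.of fun (_ : Fin 1) (k : {k : Fin n // k ≠ j}) => Φ⁻¹ j k.val) =
      (-(Φ⁻¹ j j)) • wienerRow Φ j := by
    unfold wienerRow
    rw [← Matrix.smul_mul, ← key, Matrix.mul_nonsing_inv_cancel_right _ _ hdet']
  have h := congrFun (congrFun key2 0) ⟨i, hij⟩
  simp only [Matrix.of_apply, Matrix.smul_apply, smul_eq_mul] at h
  rw [h]
  simp [hpos]
end

section
/- Let H be an n×n complex matrix, let d : Fin n → ℂ with d k ≠ 0 for every k, and set M := (1 − H)ᴴ * Matrix.diagonal (fun k => (d k)⁻¹) * (1 − H). Let i ≠ j be indices such that H j i = 0, H i j = 0, and for every k, H k j = 0 or H k i = 0. Then M j i = 0. (This is the core computation of the paper's main theorem: entry (j,i) of Φ_{xx}⁻¹ = (I−H)* Φ_e⁻¹ (I−H) vanishes whenever node N_i is neither a parent, nor a child, nor a co-parent of node N_j.) -/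
open Matrix

theorem stmt_4 {n : ℕ} (H : Matrix (Fin n) (Fin n) ℂ) (d : Fin n → ℂ)
    (hd : ∀ k, d k ≠ 0) (i j : Fin n) (hij : i ≠ j)
    (hji : H j i = 0) (hijz : H i j = 0)
    (hco : ∀ k, H k j = 0 ∨ H k i = 0)
    (M : Matrix (Fin n) (Fin n) ℂ)
    (hM : M = (1 - H)ᴴ * Matrix.diagonal (fun k => (d k)⁻¹) * (1 - H)) :
    M j i = 0 := by
  subst hM
  rw [Matrix.mul_apply]
  apply Finset.sum_eq_zero
  intro k _
  rw [Matrix.mul_diagonal, Matrix.conjTranspose_apply, Matrix.sub_apply, Matrix.sub_apply]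
  by_cases h1 : k = j
  · subst h1
    rw [Matrix.one_apply_ne (Ne.symm hij), hji]
    simp
  · by_cases h2 : k = i
    · subst h2
      rw [Matrix.one_apply_ne hij, hijz]
      simp
    · rw [Matrix.one_apply_ne h1, Matrix.one_apply_ne h2]
      rcases hco k with h | h <;> simp [h]
end

section
/- Let A : Fin n → Fin n → Prop be an asymmetric edge relation (A i j → ¬ A j i), let H : Matrix (Fin n) (Fin n) ℂ satisfy the support condition that H j i ≠ 0 implies A i j, let d : Fin n → ℝ with d k > 0 for all k, assume 1 − H is invertible, and set Φ := (1 − H)⁻¹ * Matrix.diagonal (fun k => (d k : ℂ)) * ((1 − H)⁻¹)ᴴ. Then Φ is Hermitian positive definite, and for any distinct i, j such that N_i is not a kin of N_j (¬ A i j, ¬ A j i, and there is no k with A j k ∧ A i k), the entry of the Wiener row W_j of Φ at j corresponding to index i is zero. (This is the paper's main theorem on the sparsity of the non-causal Wiener filter for a well-posed, topologically detectable linear dynamic graph, stated at a fixed frequency: W_{ji}(z) ≠ 0 implies (N_i, N_j) ∈ kin(G).) -/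
open Matrix
open scoped ComplexOrder

theorem stmt_5 {n : ℕ} (A : Fin n → Fin n → Prop)
    (hA : ∀ i j, A i j → ¬ A j i)
    (H : Matrix (Fin n) (Fin n) ℂ)
    (hH : ∀ i j, H j i ≠ 0 → A i j)
    (d : Fin n → ℝ) (hd : ∀ k, 0 < d k)
    (hinv : IsUnit (1 - H).det)
    (Φ : Matrix (Fin n) (Fin n) ℂ)
    (hΦ : Φ = (1 - H)⁻¹ * Matrix.diagonal (fun k => (d k : ℂ)) * ((1 - H)⁻¹)ᴴ) :
    Φ.PosDef ∧
      ∀ (i j : Fin n) (hij : i ≠ j),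
        ¬ A i j → ¬ A j i → (¬ ∃ k, A j k ∧ A i k) →
        wienerRow Φ j 0 ⟨i, hij⟩ = 0 := by
  have hBu : IsUnit (1 - H) := (Matrix.isUnit_iff_isUnit_det _).2 hinv
  have hBi : IsUnit (1 - H)⁻¹ := (Matrix.isUnit_nonsing_inv_iff).2 hBu
  have hD : (Matrix.diagonal (fun k => (d k : ℂ))).PosDef :=
    Matrix.posDef_diagonal_iff.2 (fun k => by exact_mod_cast hd k)
  have hpd : Φ.PosDef := by
    rw [hΦ]
    exact hD.mul_mul_conjTranspose_same (Matrix.vecMul_injective_of_isUnit hBi)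
  refine ⟨hpd, ?_⟩
  intro i j hij h1 h2 h3
  obtain ⟨P, hP⟩ : ∃ P, P = (1 - H)ᴴ * Matrix.diagonal (fun k => ((d k : ℂ))⁻¹) * (1 - H) :=
    ⟨_, rfl⟩
  have hDD : Matrix.diagonal (fun k => ((d k : ℂ))⁻¹) * Matrix.diagonal (fun k => (d k : ℂ)) = 1 := by
    rw [Matrix.diagonal_mul_diagonal, ← Matrix.diagonal_one]
    congr 1
    funext k
    exact inv_mul_cancel₀ (by exact_mod_cast (hd k).ne')
  have hPΦ : P * Φ = 1 := by
    rw [hP, hΦ]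
    calc _ = (1 - H)ᴴ * (Matrix.diagonal (fun k => ((d k : ℂ))⁻¹) * ((1 - H) * (1 - H)⁻¹) *
              Matrix.diagonal (fun k => (d k : ℂ))) * ((1 - H)⁻¹)ᴴ := by
            simp only [Matrix.mul_assoc]
      _ = 1 := by
            rw [Matrix.mul_nonsing_inv _ hinv, Matrix.mul_one, hDD, Matrix.mul_one,
              ← Matrix.conjTranspose_mul, Matrix.nonsing_inv_mul _ hinv, Matrix.conjTranspose_one]
  have hPinv : Φ⁻¹ = P := Matrix.inv_eq_left_inv hPΦ
  have hPjj : P j j ≠ 0 := by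
    rw [← hPinv]
    exact (hpd.inv.diag_pos).ne'
  have hPji : P j i = 0 := by
    rw [hP, Matrix.mul_apply]
    refine Finset.sum_eq_zero fun k _ => ?_
    rw [Matrix.mul_diagonal, Matrix.conjTranspose_apply]
    have hz : (1 - H) k j = 0 ∨ (1 - H) k i = 0 := by
      have e1 : H j i = 0 := by
        by_contra h
        exact h1 (hH _ _ h)
      have e2 : H i j = 0 := by
        by_contra h
        exact h2 (hH _ _ h)
      by_cases hkj : k = j
      · right
        subst hkj
        simp [e1, Matrix.one_apply, hij.symm]
      by_cases hki : k = i
      · left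
        subst hki
        simp [e2, Matrix.one_apply, hij]
      by_contra h
      rw [not_or] at h
      apply h3
      refine ⟨k, hH _ _ ?_, hH _ _ ?_⟩
      · simpa [Matrix.one_apply, hkj] using h.1
      · simpa [Matrix.one_apply, hki] using h.2
    rcases hz with hz | hz <;> simp [hz]
  have hsub : (Φ.submatrix (fun k : {k : Fin n // k ≠ j} => k.val)
      (fun k : {k : Fin n // k ≠ j} => k.val)).PosDef :=
    hpd.submatrix Subtype.val_injective
  have hsu := (Matrix.isUnit_iff_isUnit_det _).1 hsub.isUnit
  have hc : (Matrix.of fun (_ : Fin 1) (k : {k : Fin n // k ≠ j}) => Φ j k.val) =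
      (Matrix.of fun (_ : Fin 1) (k : {k : Fin n // k ≠ j}) => -(P j k.val) / P j j) *
      (Φ.submatrix (fun k : {k : Fin n // k ≠ j} => k.val)
      (fun k : {k : Fin n // k ≠ j} => k.val)) := by
    ext a l
    have h := congrFun (congrFun hPΦ j) l.val
    rw [Matrix.mul_apply, Matrix.one_apply_ne l.2.symm,
      Fintype.sum_eq_add_sum_subtype_ne _ j] at h
    simp only [Matrix.mul_apply, Matrix.of_apply, Matrix.submatrix_apply]
    have e : ∀ x : {k : Fin n // k ≠ j}, -P j x.val / P j j * Φ x.val l.val =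
        (-(P j j)⁻¹) * (P j x.val * Φ x.val l.val) := fun x => by ring
    simp only [e]
    rw [← Finset.mul_sum, eq_neg_of_add_eq_zero_right h]
    field_simp
  unfold wienerRow
  rw [hc, Matrix.mul_assoc, Matrix.mul_nonsing_inv _ hsu, Matrix.mul_one]
  simp [hPji]
end

section
/- Let A : Fin n → Fin n → Prop be an asymmetric edge relation (A i j → ¬ A j i) that is self-kin, i.e., for all distinct i, j, if A i j ∨ A j i ∨ (∃ k, A i k ∧ A j k) then A i j ∨ A j i. Let H : Matrix (Fin n) (Fin n) ℂ satisfy H j i ≠ 0 → A i j, let d : Fin n → ℝ be positive, assume 1 − H invertible, and set Φ := (1 − H)⁻¹ * Matrix.diagonal (fun k => (d k : ℂ)) * ((1 − H)⁻¹)ᴴ. Then for any distinct i, j, if the entry of the Wiener row W_j of Φ at j corresponding to index i is nonzero, then A i j ∨ A j i, i.e., {N_i, N_j} is an edge of the topology of the graph. (This is the paper's corollary: for self-kin linear dynamic graphs, nonzero Wiener filter entries exactly identify links of the topology.) -/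
open Matrix
open scoped ComplexOrder

theorem stmt_6 {n : ℕ} (A : Fin n → Fin n → Prop)
    (hA : ∀ i j, A i j → ¬ A j i)
    (hselfkin : ∀ i j : Fin n, i ≠ j →
      (A i j ∨ A j i ∨ (∃ k, A i k ∧ A j k)) → A i j ∨ A j i)
    (H : Matrix (Fin n) (Fin n) ℂ)
    (hH : ∀ i j, H j i ≠ 0 → A i j)
    (d : Fin n → ℝ) (hd : ∀ k, 0 < d k)
    (hinv : IsUnit (1 - H).det)
    (Φ : Matrix (Fin n) (Fin n) ℂ)
    (hΦ : Φ = (1 - H)⁻¹ * Matrix.diagonal (fun k => (d k : ℂ)) * ((1 - H)⁻¹)ᴴ) :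
    ∀ (i j : Fin n) (hij : i ≠ j),
      wienerRow Φ j 0 ⟨i, hij⟩ ≠ 0 → A i j ∨ A j i := by
  intro i j hij hW
  set B : Matrix (Fin n) (Fin n) ℂ := 1 - H with hB
  set D : Matrix (Fin n) (Fin n) ℂ := Matrix.diagonal (fun k => (d k : ℂ)) with hD
  set E : Matrix (Fin n) (Fin n) ℂ := Matrix.diagonal (fun k => ((d k)⁻¹ : ℂ)) with hE
  have hED : E * D = 1 := by
    rw [hE, hD, Matrix.diagonal_mul_diagonal, ← Matrix.diagonal_one]
    congr 1
    funext k
    have : (d k : ℂ) ≠ 0 := by exact_mod_cast (hd k).ne'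
    simp [this]
  have hKΦ : (Bᴴ * E * B) * Φ = 1 := by
    have h1 : B * B⁻¹ = 1 := Matrix.mul_nonsing_inv _ hinv
    have h2 : Bᴴ * (B⁻¹)ᴴ = 1 := by
      rw [← Matrix.conjTranspose_mul, Matrix.nonsing_inv_mul _ hinv, Matrix.conjTranspose_one]
    calc (Bᴴ * E * B) * Φ = Bᴴ * (E * ((B * B⁻¹) * D)) * (B⁻¹)ᴴ := by
          rw [hΦ]; simp only [Matrix.mul_assoc]
      _ = 1 := by rw [h1, Matrix.one_mul, hED, Matrix.mul_one, h2]
  have hKe : ∀ a b, (Bᴴ * E * B) a b = ∑ k, star (B k a) * (d k : ℂ)⁻¹ * B k b := by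
    intro a b
    rw [Matrix.mul_apply]
    simp only [hE, Matrix.mul_diagonal, Matrix.conjTranspose_apply]
  set K := Bᴴ * E * B with hK
  have hHjj : H j j = 0 := by
    by_contra h
    exact hA _ _ (hH _ _ h) (hH _ _ h)
  have hKjj : K j j ≠ 0 := by
    have h1 : K j j = ((∑ k, Complex.normSq (B k j) * (d k)⁻¹ : ℝ) : ℂ) := by
      rw [hKe]
      push_cast
      refine Finset.sum_congr rfl fun k _ => ?_
      rw [Complex.normSq_eq_conj_mul_self]
      simp only [starRingEnd_apply]
      ring
    rw [h1]
    have h2 : 0 < ∑ k, Complex.normSq (B k j) * (d k)⁻¹ := by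
      refine Finset.sum_pos' (fun k _ => mul_nonneg (Complex.normSq_nonneg _)
        (inv_nonneg.2 (hd k).le)) ⟨j, Finset.mem_univ _, ?_⟩
      simp [hB, hHjj, hd j]
    exact_mod_cast h2.ne'
  have hBne : ∀ k a, B k a ≠ 0 → k = a ∨ A a k := by
    intro k a h
    by_cases hka : k = a
    · exact Or.inl hka
    · right
      apply hH
      intro h0
      apply h
      simp [hB, Matrix.one_apply_ne hka, h0]
  have key : K j i ≠ 0 → A i j ∨ A j i := by
    intro h
    rw [hKe] at h
    obtain ⟨k, -, hk⟩ := Finset.exists_ne_zero_of_sum_ne_zero h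
    have h1 : B k j ≠ 0 := by
      intro h0; apply hk; simp [h0]
    have h2 : B k i ≠ 0 := by
      intro h0; apply hk; simp [h0]
    rcases hBne _ _ h1 with rfl | h1
    · rcases hBne _ _ h2 with rfl | h2
      · exact absurd rfl hij
      · exact Or.inl h2
    · rcases hBne _ _ h2 with rfl | h2
      · exact Or.inr h1
      · exact hselfkin i j hij (Or.inr (Or.inr ⟨k, h2, h1⟩))
  apply key
  intro h0
  apply hW
  unfold wienerRow
  set S := Φ.submatrix (fun k : {k : Fin n // k ≠ j} => k.val)
      (fun k : {k : Fin n // k ≠ j} => k.val) with hS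
  by_cases hdet : IsUnit S.det
  · have hc : (Matrix.of fun (_ : Fin 1) (k : {k : Fin n // k ≠ j}) => Φ j k.val) =
        (Matrix.of fun (_ : Fin 1) (k : {k : Fin n // k ≠ j}) => - (K j j)⁻¹ * K j k.val) * S := by
      ext a l
      have h1 : (K * Φ) j l.val = 0 := by
        rw [hKΦ, Matrix.one_apply_ne l.2.symm]
      rw [Matrix.mul_apply, Fintype.sum_eq_add_sum_subtype_ne _ j] at h1
      simp only [Matrix.mul_apply, Matrix.of_apply, hS, Matrix.submatrix_apply, mul_assoc]
      rw [← Finset.mul_sum, ← neg_eq_of_add_eq_zero_right h1]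
      field_simp
    rw [hc, Matrix.mul_assoc, Matrix.mul_nonsing_inv _ hdet, Matrix.mul_one]
    simp [h0]
  · rw [Matrix.nonsing_inv_apply_not_isUnit _ hdet]
    simp
end

section
/- Let R be a commutative ring, H : Matrix (Fin n) (Fin n) R, and fix j with H j j = 0. Let e, x : Fin n → R satisfy x = e + H.mulVec x. Define ε, ξ : Fin n → R by ε j := 0, ε k := e k + H k j * e j for k ≠ j, ξ j := ∑ i, H j i * x i, and ξ k := x k for k ≠ j. Then (1 − H).mulVec ξ = ε. (This is the algebraic identity at the heart of the paper's lemma showing that for i ≠ j every output x_i lies in the span of the modified noise processes e_k + H_{kj}(z) e_j over the children k of N_j together with the e_k for all other k ≠ j.) -/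
open Matrix

theorem stmt_7 {n : ℕ} {R : Type*} [CommRing R]
    (H : Matrix (Fin n) (Fin n) R) (j : Fin n) (hjj : H j j = 0)
    (e x : Fin n → R) (hx : x = e + H.mulVec x)
    (ε ξ : Fin n → R)
    (hε : ∀ k, ε k = if k = j then 0 else e k + H k j * e j)
    (hξ : ∀ k, ξ k = if k = j then ∑ i, H j i * x i else x k) :
    (1 - H).mulVec ξ = ε := by
  have hk : ∀ k, x k = e k + ∑ i, H k i * x i := fun k => congrFun hx k
  have h1 : ∀ k, ξ k = x k - if k = j then e j else 0 := by
    intro k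
    rw [hξ k]
    split_ifs with h
    · subst h
      rw [hk k]
      ring
    · ring
  have h2 : ∀ k, ∑ i, H k i * ξ i = ∑ i, H k i * x i - H k j * e j := by
    intro k
    simp [h1, mul_sub, Finset.sum_sub_distrib]
  funext k
  rw [Matrix.sub_mulVec, Matrix.one_mulVec, Pi.sub_apply, hε k]
  change ξ k - ∑ i, H k i * ξ i = _
  rw [h2, h1]
  have := hk k
  split_ifs with h
  · subst h
    rw [hjj]
    linear_combination this
  · linear_combination this
end

section
/- Let σ > 0 be real, let h : Matrix (Fin n) (Fin 1) ℂ be a column vector, and let D be an n×n Hermitian positive definite complex matrix. Set M := σ • (h * hᴴ) + D. Then the scalar σ * ((hᴴ * M⁻¹ * h) 0 0) is a real number lying in the interval [0, 1). (This is the paper's claim that ‖Ĉ_{j*}(ω) H_{*j}(ω)‖ < 1, which guarantees that the parent component P̂_{ji} = (1 − Ĉ_{j*} H_{*j}) H_{ji} of the Wiener filter is nonzero exactly when H_{ji} ≠ 0.) -/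
open Matrix
open scoped ComplexOrder

theorem stmt_10 {n : ℕ} (σ : ℝ) (hσ : 0 < σ)
    (h : Matrix (Fin n) (Fin 1) ℂ)
    (D : Matrix (Fin n) (Fin n) ℂ) (hD : D.PosDef)
    (M : Matrix (Fin n) (Fin n) ℂ) (hM : M = σ • (h * hᴴ) + D) :
    ∃ r : ℝ, (σ : ℂ) * ((hᴴ * M⁻¹ * h) 0 0) = (r : ℂ) ∧ r ∈ Set.Ico (0 : ℝ) 1 := by
  have hc : σ • (h * hᴴ) = (σ : ℂ) • (h * hᴴ) := by
    ext i j
    simp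
  have hσc : (0 : ℂ) ≤ (σ : ℂ) := by exact_mod_cast hσ.le
  have hMpd : M.PosDef := by
    rw [hM, hc]
    exact Matrix.PosDef.posSemidef_add
      ((posSemidef_self_mul_conjTranspose h).smul hσc) hD
  have hMu : IsUnit M.det := (Matrix.isUnit_iff_isUnit_det M).1 hMpd.isUnit
  have hDu : IsUnit D.det := (Matrix.isUnit_iff_isUnit_det D).1 hD.isUnit
  have ha : 0 ≤ (hᴴ * D⁻¹ * h) 0 0 :=
    (hD.inv.posSemidef.conjTranspose_mul_mul_same h).diag_nonneg
  have key : hᴴ * D⁻¹ * h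
      = (σ : ℂ) • ((hᴴ * D⁻¹ * h) * (hᴴ * M⁻¹ * h)) + hᴴ * M⁻¹ * h := by
    calc hᴴ * D⁻¹ * h = hᴴ * D⁻¹ * (M * M⁻¹) * h := by
          rw [Matrix.mul_nonsing_inv M hMu, Matrix.mul_one]
      _ = hᴴ * D⁻¹ * (((σ : ℂ) • (h * hᴴ) + D) * M⁻¹) * h := by
          rw [← hc, ← hM]
      _ = (σ : ℂ) • ((hᴴ * D⁻¹ * h) * (hᴴ * M⁻¹ * h)) + hᴴ * (D⁻¹ * D) * M⁻¹ * h := by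
          simp only [Matrix.add_mul, Matrix.mul_add, Matrix.smul_mul, Matrix.mul_smul,
            Matrix.mul_assoc]
      _ = _ := by rw [Matrix.nonsing_inv_mul D hDu, Matrix.mul_one]
  have k0 := congrFun (congrFun key 0) 0
  rw [Matrix.add_apply, Matrix.smul_apply, Matrix.mul_apply (M := hᴴ * D⁻¹ * h),
    Fin.sum_univ_one, smul_eq_mul] at k0
  generalize (hᴴ * D⁻¹ * h) 0 0 = a at ha k0
  generalize (hᴴ * M⁻¹ * h) 0 0 = g at k0 ⊢
  obtain ⟨ha1, ha2⟩ := Complex.le_def.1 ha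
  obtain ⟨x, rfl⟩ : ∃ x : ℝ, a = (x : ℂ) := ⟨a.re, by
    apply Complex.ext
    · simp
    · simpa using ha2.symm⟩
  have hx : 0 ≤ x := by simpa using ha1
  have hp : 0 < 1 + σ * x := by positivity
  have hpc : (1 + (σ : ℂ) * x) ≠ 0 := by exact_mod_cast hp.ne'
  refine ⟨σ * x / (1 + σ * x), ?_, by positivity, ?_⟩
  · push_cast
    rw [eq_div_iff hpc]
    linear_combination -(σ : ℂ) * k0
  · rw [div_lt_one hp]
    linarith
end

section
/- Let σ > 0 be real, let d : Fin n → ℝ be positive, let D := Matrix.diagonal (fun k => (d k : ℂ)), let h : Matrix (Fin n) (Fin 1) ℂ be a column vector, and set M := σ • (h * hᴴ) + D. Then for every index i, the i-th entry (σ • (hᴴ * M⁻¹)) 0 i is nonzero if and only if h i 0 ≠ 0. (This is part of the paper's lemma on the three components of the Wiener filter: the child component Ĉ_{ji} is nonzero if and only if N_i is a child of N_j, i.e., if and only if the (i,j) entry H_{ij} of the transfer matrix is nonzero.) -/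
open Matrix

theorem stmt_11 {n : ℕ} (σ : ℝ) (hσ : 0 < σ)
    (d : Fin n → ℝ) (hd : ∀ k, 0 < d k)
    (D : Matrix (Fin n) (Fin n) ℂ)
    (hD : D = Matrix.diagonal (fun k => (d k : ℂ)))
    (h : Matrix (Fin n) (Fin 1) ℂ)
    (M : Matrix (Fin n) (Fin n) ℂ) (hM : M = σ • (h * hᴴ) + D) :
    ∀ i : Fin n, (σ • (hᴴ * M⁻¹)) 0 i ≠ 0 ↔ h i 0 ≠ 0 := by
  open scoped ComplexOrder in
  have hpd : M.PosDef := by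
    rw [hM, hD]
    refine Matrix.PosDef.posSemidef_add ?_ ?_
    · exact (Matrix.posSemidef_self_mul_conjTranspose h).smul hσ.le
    · refine Matrix.PosDef.diagonal ?_
      intro k
      exact_mod_cast hd k
  have hu : IsUnit M.det := (Matrix.isUnit_iff_isUnit_det M).1 hpd.isUnit
  obtain ⟨x, hx⟩ : ∃ x, x = hᴴ * M⁻¹ := ⟨_, rfl⟩
  have hxM : x * M = hᴴ := by
    rw [hx, Matrix.mul_assoc, Matrix.nonsing_inv_mul M hu, Matrix.mul_one]
  rw [hM, hD, Matrix.mul_add, Matrix.mul_smul, ← Matrix.mul_assoc] at hxM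
  have key : ∀ i, (σ : ℂ) * ((x * h) 0 0 * star (h i 0)) + x 0 i * (d i : ℂ) = star (h i 0) := by
    intro i
    have := congrFun (congrFun hxM 0) i
    rw [Matrix.add_apply, Matrix.mul_diagonal, Matrix.smul_apply,
      Matrix.mul_apply, Fin.sum_univ_one, Matrix.conjTranspose_apply] at this
    simpa only [Complex.real_smul] using this
  have hd' : ∀ i, (d i : ℂ) ≠ 0 := fun i => by exact_mod_cast (hd i).ne'
  have hσ' : (σ : ℂ) ≠ 0 := by exact_mod_cast hσ.ne'
  have hc : 1 - (σ : ℂ) * (x * h) 0 0 ≠ 0 := by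
    intro h0
    have hx0 : ∀ i, x 0 i = 0 := by
      intro i
      have : x 0 i * (d i : ℂ) = 0 := by
        linear_combination key i + star (h i 0) * h0
      exact (mul_eq_zero.1 this).resolve_right (hd' i)
    have : (x * h) 0 0 = 0 := by
      rw [Matrix.mul_apply]
      exact Finset.sum_eq_zero fun i _ => by rw [hx0, zero_mul]
    rw [this] at h0
    simp at h0
  intro i
  rw [← hx, Matrix.smul_apply, Complex.real_smul]
  have e : x 0 i * (d i : ℂ) = (1 - (σ : ℂ) * (x * h) 0 0) * star (h i 0) := by
    linear_combination key i
  refine not_congr ⟨fun hz => ?_, fun hz => ?_⟩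
  · have hz' := (mul_eq_zero.1 hz).resolve_left hσ'
    rw [hz', zero_mul] at e
    exact star_eq_zero.1 ((mul_eq_zero.1 e.symm).resolve_left hc)
  · rw [hz, star_zero, mul_zero] at e
    rw [(mul_eq_zero.1 e).resolve_right (hd' i), mul_zero]
end

section
/- Let H : Matrix (Fin n) (Fin n) ℂ have zero diagonal (H k k = 0 for all k), let d : Fin n → ℝ be positive, and fix j. Set σ := d j, d' := Function.update d j 1, D_j := Matrix.diagonal (fun k => (d' k : ℂ)), and let h be the j-th column of H (h k 0 = H k j). Define the row Ĉ := σ • (hᴴ * (σ • (h * hᴴ) + D_j)⁻¹), and for i ≠ j set P̂_i := (1 − ∑ k, Ĉ 0 k * H k j) * H j i and K̂_i := −∑ k, Ĉ 0 k * H k i. Then: (a) Ĉ 0 i ≠ 0 if and only if H i j ≠ 0 (N_i is a child of N_j); (b) P̂_i ≠ 0 if and only if H j i ≠ 0 (N_i is a parent of N_j); (c) K̂_i ≠ 0 implies there exists k ≠ j with H k j ≠ 0 and H k i ≠ 0 (N_i is a parent of a child of N_j). (This is the paper's lemma characterizing when each of the three components Ĉ_{ji}, P̂_{ji}, K̂_{ji}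 of the Wiener filter is nonzero.) -/
open Matrix
open scoped ComplexOrder

theorem stmt_12 {n : ℕ} (H : Matrix (Fin n) (Fin n) ℂ)
    (hdiag : ∀ k, H k k = 0)
    (d : Fin n → ℝ) (hd : ∀ k, 0 < d k) (j : Fin n)
    (σ : ℝ) (hσ : σ = d j)
    (d' : Fin n → ℝ) (hd' : d' = Function.update d j 1)
    (Dj : Matrix (Fin n) (Fin n) ℂ)
    (hDj : Dj = Matrix.diagonal (fun k => (d' k : ℂ)))
    (h : Matrix (Fin n) (Fin 1) ℂ) (hh : ∀ k, h k 0 = H k j)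
    (C : Matrix (Fin 1) (Fin n) ℂ)
    (hC : C = σ • (hᴴ * (σ • (h * hᴴ) + Dj)⁻¹))
    (P K : Fin n → ℂ)
    (hP : ∀ i, i ≠ j → P i = (1 - ∑ k, C 0 k * H k j) * H j i)
    (hK : ∀ i, i ≠ j → K i = -∑ k, C 0 k * H k i) :
    (∀ i : Fin n, C 0 i ≠ 0 ↔ H i j ≠ 0) ∧
    (∀ i : Fin n, i ≠ j → (P i ≠ 0 ↔ H j i ≠ 0)) ∧
    (∀ i : Fin n, i ≠ j → K i ≠ 0 → ∃ k, k ≠ j ∧ H k j ≠ 0 ∧ H k i ≠ 0) := by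
  have hpos : ∀ k, 0 < d' k := by
    intro k
    rw [hd']
    by_cases hk : k = j
    · subst hk; simp
    · simp [Function.update_of_ne hk, hd k]
  have hσp : 0 < σ := hσ ▸ hd j
  have hDpd : Dj.PosDef := by
    rw [hDj]
    refine Matrix.PosDef.diagonal ?_
    intro k
    exact_mod_cast hpos k
  have hpsd : (σ • (h * hᴴ)).PosSemidef :=
    (Matrix.posSemidef_self_mul_conjTranspose h).smul hσp.le
  have hM : (σ • (h * hᴴ) + Dj).PosDef := Matrix.PosDef.posSemidef_add hpsd hDpd
  have hu : IsUnit (σ • (h * hᴴ) + Dj).det := (Matrix.isUnit_iff_isUnit_det _).1 hM.isUnit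
  have hCM : C * (σ • (h * hᴴ) + Dj) = σ • hᴴ := by
    rw [hC, Matrix.smul_mul, Matrix.mul_assoc, Matrix.nonsing_inv_mul _ hu, Matrix.mul_one]
  have key : ∀ i, C 0 i * (d' i : ℂ) = σ * (1 - ∑ k, C 0 k * H k j) * star (H i j) := by
    intro i
    have e := congrFun (congrFun hCM 0) i
    rw [Matrix.mul_add, Matrix.mul_smul, ← Matrix.mul_assoc, hDj] at e
    simp only [Matrix.add_apply, Matrix.smul_apply, Matrix.mul_diagonal, Matrix.conjTranspose_apply,
      Complex.real_smul] at e
    rw [Matrix.mul_apply, Fin.sum_univ_one, Matrix.mul_apply] at e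
    simp only [Matrix.conjTranspose_apply, hh] at e
    linear_combination e
  have hs : (1 - ∑ k, C 0 k * H k j) ≠ 0 := by
    intro h0
    have hz : ∀ i, C 0 i = 0 := by
      intro i
      have e := key i
      rw [h0] at e
      have : (d' i : ℂ) ≠ 0 := by exact_mod_cast (hpos i).ne'
      simpa [this] using e
    simp [hz] at h0
  have ha : ∀ i : Fin n, C 0 i ≠ 0 ↔ H i j ≠ 0 := by
    intro i
    have e := key i
    have h1 : (d' i : ℂ) ≠ 0 := by exact_mod_cast (hpos i).ne'
    have h2 : (σ : ℂ) ≠ 0 := by exact_mod_cast hσp.ne'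
    rw [not_iff_not]
    constructor
    · intro h0
      rw [h0, zero_mul] at e
      rcases mul_eq_zero.1 e.symm with h3 | h3
      · exact absurd h3 (mul_ne_zero h2 hs)
      · exact star_eq_zero.1 h3
    · intro h0
      rw [h0, star_zero, mul_zero] at e
      exact (mul_eq_zero.1 e).resolve_right h1
  refine ⟨ha, ?_, ?_⟩
  · intro i hi
    rw [hP i hi, mul_ne_zero_iff]
    exact ⟨fun h => h.2, fun h => ⟨hs, h⟩⟩
  · intro i hi hKi
    rw [hK i hi, neg_ne_zero] at hKi
    obtain ⟨k, -, hk⟩ := Finset.exists_ne_zero_of_sum_ne_zero hKi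
    have hc := (ha k).1 (left_ne_zero_of_mul hk)
    refine ⟨k, ?_, hc, right_ne_zero_of_mul hk⟩
    rintro rfl
    exact hc (hdiag k)
end

section
/- Let H : Matrix (Fin n) (Fin n) ℂ have zero diagonal (H k k = 0 for all k), let d : Fin n → ℝ be positive, assume 1 − H is invertible, and set Φ := (1 − H)⁻¹ * Matrix.diagonal (fun k => (d k : ℂ)) * ((1 − H)⁻¹)ᴴ. Fix j and define, with σ := d j, d' := Function.update d j 1, D_j := Matrix.diagonal (fun k => (d' k : ℂ)), and h the j-th column of H: the row Ĉ := σ • (hᴴ * (σ • (h * hᴴ) + D_j)⁻¹), P̂_i := (1 − ∑ k, Ĉ 0 k * H k j) * H j i, and K̂_i := −∑ k, Ĉ 0 k * H k i. Then Φ is Hermitian positive definite, Ĉ 0 j = 0, and for every i ≠ j the entry of the Wiener row W_j of Φ at j corresponding to index i equals Ĉ 0 i + P̂_i + K̂_i. (This is the paper's theorem giving the explicit decomposition W_{ji} = Ĉ_{ji} + P̂_{ji} + K̂_{ji} of the non-causal Wiener filter of a well-posed, topologically detectable linear dynamic graph, stated at a fixed frequency.) -/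
open Matrix
open scoped ComplexOrder

theorem stmt_13 {n : ℕ} (H : Matrix (Fin n) (Fin n) ℂ)
    (hdiag : ∀ k, H k k = 0)
    (d : Fin n → ℝ) (hd : ∀ k, 0 < d k)
    (hinv : IsUnit (1 - H).det)
    (Φ : Matrix (Fin n) (Fin n) ℂ)
    (hΦ : Φ = (1 - H)⁻¹ * Matrix.diagonal (fun k => (d k : ℂ)) * ((1 - H)⁻¹)ᴴ)
    (j : Fin n)
    (σ : ℝ) (hσ : σ = d j)
    (d' : Fin n → ℝ) (hd' : d' = Function.update d j 1)
    (Dj : Matrix (Fin n) (Fin n) ℂ)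
    (hDj : Dj = Matrix.diagonal (fun k => (d' k : ℂ)))
    (h : Matrix (Fin n) (Fin 1) ℂ) (hh : ∀ k, h k 0 = H k j)
    (C : Matrix (Fin 1) (Fin n) ℂ)
    (hC : C = σ • (hᴴ * (σ • (h * hᴴ) + Dj)⁻¹))
    (P K : Fin n → ℂ)
    (hP : ∀ i, P i = (1 - ∑ k, C 0 k * H k j) * H j i)
    (hK : ∀ i, K i = -∑ k, C 0 k * H k i) :
    Φ.PosDef ∧ C 0 j = 0 ∧
      ∀ (i : Fin n) (hij : i ≠ j),
        wienerRow Φ j 0 ⟨i, hij⟩ = C 0 i + P i + K i := by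
  have hDpos : (Matrix.diagonal (fun k => (d k : ℂ))).PosDef :=
    Matrix.PosDef.diagonal (fun k => by exact_mod_cast hd k)
  have hunit : IsUnit (1 - H) := (Matrix.isUnit_iff_isUnit_det _).2 hinv
  have hinj : Function.Injective ((1 - H)⁻¹).vecMul := by
    apply Matrix.vecMul_injective_of_isUnit
    exact (Matrix.isUnit_nonsing_inv_iff).2 hunit
  have hΦpos : Φ.PosDef := by
    rw [hΦ]
    exact hDpos.mul_mul_conjTranspose_same hinj
  have hσpos : 0 < σ := hσ ▸ hd j
  have hd'pos : ∀ k, 0 < d' k := by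
    intro k
    rw [hd']
    by_cases hk : k = j
    · subst hk; simp
    · simp [hk, hd k]
  have hDjpos : Dj.PosDef := by
    rw [hDj]
    exact Matrix.PosDef.diagonal (fun k => by exact_mod_cast hd'pos k)
  have hMpos : (σ • (h * hᴴ) + Dj).PosDef := by
    apply Matrix.PosDef.posSemidef_add _ hDjpos
    exact (Matrix.posSemidef_self_mul_conjTranspose h).smul hσpos.le
  have hCM : C * (σ • (h * hᴴ) + Dj) = σ • hᴴ := by
    rw [hC, Matrix.smul_mul, Matrix.mul_assoc, Matrix.nonsing_inv_mul, Matrix.mul_one]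
    exact (Matrix.isUnit_iff_isUnit_det _).1 hMpos.isUnit
  set s : ℂ := ∑ k, C 0 k * H k j with hs
  have hCk : ∀ k, C 0 k * d' k = σ * (1 - s) * star (H k j) := by
    intro k
    have e := congrFun (congrFun hCM 0) k
    rw [Matrix.mul_add, Matrix.mul_smul, ← Matrix.mul_assoc, hDj] at e
    have e2 : (C * h) 0 0 = s := by simp [Matrix.mul_apply, hs, hh]
    simp only [Matrix.add_apply, Matrix.smul_apply, Matrix.mul_diagonal,
      Matrix.mul_apply (M := C * h), Finset.univ_unique, Fin.default_eq_zero,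
      Finset.sum_singleton, e2, Matrix.conjTranspose_apply, hh, Complex.real_smul] at e
    linear_combination e
  have hCj : C 0 j = 0 := by
    have := hCk j
    simpa [hdiag, hd'] using this
  refine ⟨hΦpos, hCj, ?_⟩
  let v : Fin n → ℂ := fun i => C 0 i + P i + K i
  let a : Fin n → ℂ := fun i => C 0 i - (1 - s) * (1 : Matrix (Fin n) (Fin n) ℂ) j i
  let u : Fin n → ℂ := a ᵥ* (1 - H)
  have hu : ∀ i, u i = v i - (1 - s) * (1 : Matrix (Fin n) (Fin n) ℂ) j i := by
    intro i
    simp only [u, v, a, hP, hK, Matrix.vecMul_sub, Matrix.vecMul_one, Pi.sub_apply]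
    simp only [Matrix.vecMul, dotProduct, sub_mul, Finset.sum_sub_distrib, Matrix.one_apply]
    simp
    ring
  have huj : u j = -1 := by
    rw [hu]
    simp [v, hP, hK, hCj, hdiag, ← hs]
    ring
  have haD : a ᵥ* Matrix.diagonal (fun k => (d k : ℂ)) =
      (fun i => (-(σ * (1 - s))) * (1 : Matrix (Fin n) (Fin n) ℂ) j i) ᵥ* (1 - H)ᴴ := by
    ext k
    rw [Matrix.vecMul_diagonal]
    simp only [a, Matrix.vecMul, dotProduct, Matrix.one_apply, Matrix.conjTranspose_apply,
      Matrix.sub_apply]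
    simp only [mul_ite, mul_one, mul_zero, ite_mul, zero_mul, Finset.sum_ite_eq,
      Finset.mem_univ, if_true]
    by_cases hk : k = j
    · subst hk
      simp [hCj, hdiag, hσ]
      ring
    · have := hCk k
      simp [hd', hk] at this
      simp [hk, Ne.symm hk, this]
  have huΦ : u ᵥ* Φ = fun i => (-(σ * (1 - s))) * (1 : Matrix (Fin n) (Fin n) ℂ) j i := by
    simp only [u]
    rw [hΦ, Matrix.vecMul_vecMul, ← Matrix.mul_assoc, ← Matrix.mul_assoc,
      Matrix.mul_nonsing_inv _ hinv, Matrix.one_mul, ← Matrix.vecMul_vecMul, haD,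
      Matrix.vecMul_vecMul, ← Matrix.conjTranspose_mul, Matrix.nonsing_inv_mul _ hinv,
      Matrix.conjTranspose_one, Matrix.vecMul_one]
  have hSpos : (Φ.submatrix (fun k : {k : Fin n // k ≠ j} => k.val)
      (fun k : {k : Fin n // k ≠ j} => k.val)).PosDef :=
    hΦpos.submatrix Subtype.val_injective
  have hrow : (Matrix.of fun (_ : Fin 1) (k : {k : Fin n // k ≠ j}) => Φ j k.val) =
      (Matrix.of fun (_ : Fin 1) (k : {k : Fin n // k ≠ j}) => v k.val) *
      (Φ.submatrix (fun k : {k : Fin n // k ≠ j} => k.val)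
      (fun k : {k : Fin n // k ≠ j} => k.val)) := by
    ext x k
    have e := congrFun huΦ k.val
    simp only [Matrix.vecMul, dotProduct, Matrix.one_apply, if_neg (Ne.symm k.2), mul_zero] at e
    rw [← Finset.add_sum_erase _ _ (Finset.mem_univ j), huj,
      Finset.sum_subtype (p := fun i => i ≠ j) _ (by simp)] at e
    simp only [Matrix.mul_apply, Matrix.of_apply, Matrix.submatrix_apply]
    have e3 : ∀ i : {k : Fin n // k ≠ j}, u i.val = v i.val := by
      intro i
      rw [hu, Matrix.one_apply_ne (Ne.symm i.2)]; simp
    simp only [e3] at e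
    linear_combination -e
  intro i hij
  unfold wienerRow
  rw [hrow, Matrix.mul_assoc, Matrix.mul_nonsing_inv, Matrix.mul_one]
  · rfl
  · exact (Matrix.isUnit_iff_isUnit_det _).1 hSpos.isUnit
end
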